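/- Let R be a commutative ring and M, N two R-modules. Then the weak w-projective dimension of M ⊕ N equals the supremum of the weak w-projective dimensions of M and of N (as elements of ℕ ∪ {∞}). -/

import Mathlib

/-!  Background definitions for the `w`-operation theory of Wang–Kim–Qiao.  -/

open CategoryTheory

section WTheory

variable (R : Type) [CommRing R]

/-- `J` is a Glaz–Vasconcelos ideal: it is finitely generated and the natural map
`R → Hom_R(J, R)`, sending `r` to multiplication by `r`, is bijective. -/
def IsGVIdeal (J : Ideal R) : Prop :=
  J.FG ∧ Function.Bijective fun r : R => (r • J.subtype : J →ₗ[R] R)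

/-- `M` is `GV`-torsion: every element is annihilated by some GV-ideal. -/
def IsGVTorsion (M : Type*) [AddCommGroup M] [Module R M] : Prop :=
  ∀ x : M, ∃ J : Ideal R, IsGVIdeal R J ∧ ∀ j ∈ J, j • x = 0

/-- `M` is `GV`-torsion-free: no nonzero element is annihilated by a GV-ideal. -/
def IsGVTorsionFree (M : Type*) [AddCommGroup M] [Module R M] : Prop :=
  ∀ x : M, (∃ J : Ideal R, IsGVIdeal R J ∧ ∀ j ∈ J, j • x = 0) → x = 0

/-- `Ext^n_R(M, N)`, as an `R`-module. -/
noncomputable def extM (M N : Type) [AddCommGroup M] [Module R M]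
    [AddCommGroup N] [Module R N] (n : ℕ) : ModuleCat R :=
  ((Ext R (ModuleCat R) n).obj (Opposite.op (ModuleCat.of R M))).obj (ModuleCat.of R N)

/-- `M` is a `w`-module: it is GV-torsion-free and `Ext^1_R(R/J, M) = 0`
for every GV-ideal `J`. -/
def IsWModule (M : Type) [AddCommGroup M] [Module R M] : Prop :=
  IsGVTorsionFree R M ∧
    ∀ J : Ideal R, IsGVIdeal R J → Subsingleton (extM R (R ⧸ J) M 1)

/-- `(L, ι)` is a `w`-envelope of `M`: `L` is a `w`-module, `ι : M → L` is an injective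
linear map, and its cokernel is GV-torsion. -/
def IsWEnvelope (M L : Type) [AddCommGroup M] [Module R M] [AddCommGroup L]
    [Module R L] (ι : M →ₗ[R] L) : Prop :=
  IsWModule R L ∧ Function.Injective ι ∧ IsGVTorsion R (L ⧸ LinearMap.range ι)

/-- The GV-torsion submodule `tor_GV(M)`.  (The displayed generating set is already closed
under the module operations, since the GV-ideals form a multiplicative system of ideals,
so the span coincides with the displayed set.) -/
def torGV (M : Type) [AddCommGroup M] [Module R M] : Submodule R M :=
  Submodule.span R {x : M | ∃ J : Ideal R, IsGVIdeal R J ∧ ∀ j ∈ J, j • x = 0}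

/-- `M` is `w`-projective: for every GV-torsion-free `w`-module `N` and every
`w`-envelope `(L, ι)` of `M / tor_GV(M)`, the module `Ext^1_R(L, N)` is GV-torsion. -/
def IsWProjective (M : Type) [AddCommGroup M] [Module R M] : Prop :=
  ∀ (N : Type) [AddCommGroup N] [Module R N], IsGVTorsionFree R N → IsWModule R N →
    ∀ (L : Type) [AddCommGroup L] [Module R L] (ι : (M ⧸ torGV R M) →ₗ[R] L),
      IsWEnvelope R (M ⧸ torGV R M) L ι → IsGVTorsion R (extM R L N 1)

/-- `N` belongs to the class `P_w^{†∞}`: it is GV-torsion-free and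
`Ext^k_R(M, N) = 0` for every `w`-projective `M` and every `k ≥ 1`. -/
def MemPwDaggerInfty (N : Type) [AddCommGroup N] [Module R N] : Prop :=
  IsGVTorsionFree R N ∧
    ∀ (M : Type) [AddCommGroup M] [Module R M], IsWProjective R M →
      ∀ k : ℕ, 1 ≤ k → Subsingleton (extM R M N k)

/-- `M` is weak `w`-projective: `Ext^1_R(M, N) = 0` for every `N ∈ P_w^{†∞}`. -/
def IsWeakWProjective (M : Type) [AddCommGroup M] [Module R M] : Prop :=
  ∀ (N : Type) [AddCommGroup N] [Module R N], MemPwDaggerInfty R N →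
    Subsingleton (extM R M N 1)

end WTheory

section Dimension

variable (R : Type) [CommRing R]

/-- The weak `w`-projective dimension of `M` is at most `n`: there is an exact sequence
`0 → P_n → ⋯ → P_1 → P_0 → M → 0` with every `P_i` weak `w`-projective.  (The sequence
is encoded by padding with zero modules on the left.) -/
def WWPdimLE (M : Type) [AddCommGroup M] [Module R M] (n : ℕ) : Prop :=
  ∃ (P : ℕ → ModuleCat R) (d : ∀ i : ℕ, ↥(P (i + 1)) →ₗ[R] ↥(P i)) (e : ↥(P 0) →ₗ[R] M),
    (∀ i, IsWeakWProjective R ↥(P i)) ∧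
    (∀ i, n < i → Subsingleton ↥(P i)) ∧
    Function.Surjective e ∧
    Function.Exact ⇑(d 0) ⇑e ∧
    ∀ i : ℕ, Function.Exact ⇑(d (i + 1)) ⇑(d i)

/-- The weak `w`-projective dimension of `M`, as an element of `ℕ ∪ {∞}`. -/
noncomputable def wwpd (M : Type) [AddCommGroup M] [Module R M] : ℕ∞ :=
  sInf {c : ℕ∞ | ∃ n : ℕ, c = n ∧ WWPdimLE R M n}

end Dimension

section ExtComparison

variable {R : Type} [CommRing R]

/-- The derived-functor `Ext` and the derived-category `Ext` vanish simultaneously in positive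
degrees: both are computed by a projective resolution. -/
lemma subsingleton_extM_succ_iff (M N : Type) [AddCommGroup M] [Module R M]
    [AddCommGroup N] [Module R N] (n : ℕ) :
    Subsingleton (extM R M N (n + 1)) ↔
      Subsingleton (Abelian.Ext (ModuleCat.of R M) (ModuleCat.of R N) (n + 1)) := by
  let P := projectiveResolution (ModuleCat.of R M)
  have hold : Subsingleton (extM R M N (n + 1)) ↔
      ∀ f : P.complex.X (n + 1) ⟶ ModuleCat.of R N, P.complex.d (n + 2) (n + 1) ≫ f = 0 →
        ∃ g : P.complex.X n ⟶ ModuleCat.of R N, P.complex.d (n + 1) n ≫ g = f := by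
    rw [← ModuleCat.isZero_iff_subsingleton]
    rw [extM, (P.isoExt (R := R) (n + 1) (ModuleCat.of R N)).isZero_iff,
      ← HomologicalComplex.exactAt_iff_isZero_homology,
      HomologicalComplex.exactAt_iff' _ n (n + 1) (n + 2) (by simp) (by simp),
      ShortComplex.moduleCat_exact_iff]
    exact Iff.rfl
  rw [hold]
  constructor
  · intro h
    refine subsingleton_of_forall_eq 0 fun α => ?_
    obtain ⟨f, hf, rfl⟩ := P.extMk_surjective α (n + 2) rfl
    exact (P.extMk_eq_zero_iff f (n + 2) rfl hf n rfl).2 (h f hf)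
  · intro _ f hf
    exact (P.extMk_eq_zero_iff f (n + 2) rfl hf n rfl).1 (Subsingleton.elim _ _)

variable {S : ShortComplex (ModuleCat.{0} R)} (X : ModuleCat.{0} R)

lemma ext_subsingleton_X₃_of_covariant (hS : S.ShortExact) {n : ℕ}
    (h₂ : Subsingleton (Abelian.Ext X S.X₂ n))
    (h₁ : Subsingleton (Abelian.Ext X S.X₁ (n + 1))) :
    Subsingleton (Abelian.Ext X S.X₃ n) := by
  refine subsingleton_of_forall_eq 0 fun x => ?_
  obtain ⟨y, rfl⟩ := Abelian.Ext.covariant_sequence_exact₃ X hS x rfl (Subsingleton.elim _ _)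
  rw [Subsingleton.elim y 0, Abelian.Ext.zero_comp]

lemma ext_subsingleton_X₁_of_covariant (hS : S.ShortExact) {n : ℕ}
    (h₃ : Subsingleton (Abelian.Ext X S.X₃ n))
    (h₂ : Subsingleton (Abelian.Ext X S.X₂ (n + 1))) :
    Subsingleton (Abelian.Ext X S.X₁ (n + 1)) := by
  refine subsingleton_of_forall_eq 0 fun x => ?_
  obtain ⟨y, rfl⟩ := Abelian.Ext.covariant_sequence_exact₁ X hS x (Subsingleton.elim _ _) rfl
  rw [Subsingleton.elim y 0, Abelian.Ext.zero_comp]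

lemma ext_subsingleton_X₁_of_contravariant (hS : S.ShortExact) {n : ℕ}
    (h₂ : Subsingleton (Abelian.Ext S.X₂ X n))
    (h₃ : Subsingleton (Abelian.Ext S.X₃ X (n + 1))) :
    Subsingleton (Abelian.Ext S.X₁ X n) := by
  refine subsingleton_of_forall_eq 0 fun x => ?_
  obtain ⟨y, rfl⟩ := Abelian.Ext.contravariant_sequence_exact₁ hS X x (Nat.add_comm 1 n)
    (Subsingleton.elim _ _)
  rw [Subsingleton.elim y 0, Abelian.Ext.comp_zero]

lemma ext_subsingleton_X₃_of_contravariant (hS : S.ShortExact) {n : ℕ}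
    (h₁ : Subsingleton (Abelian.Ext S.X₁ X n))
    (h₂ : Subsingleton (Abelian.Ext S.X₂ X (n + 1))) :
    Subsingleton (Abelian.Ext S.X₃ X (n + 1)) := by
  refine subsingleton_of_forall_eq 0 fun x => ?_
  obtain ⟨y, rfl⟩ := Abelian.Ext.contravariant_sequence_exact₃ hS X x (Subsingleton.elim _ _)
    (Nat.add_comm 1 n)
  rw [Subsingleton.elim y 0, Abelian.Ext.comp_zero]

lemma ext_subsingleton_of_retract {A B : ModuleCat.{0} R} (h : Retract A B) {n : ℕ}
    (hB : Subsingleton (Abelian.Ext B X n)) : Subsingleton (Abelian.Ext A X n) := by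
  refine subsingleton_of_forall_eq 0 fun x => ?_
  rw [← x.mk₀_id_comp, ← h.retract, ← Abelian.Ext.mk₀_comp_mk₀,
    Abelian.Ext.comp_assoc_of_second_deg_zero,
    Subsingleton.elim ((Abelian.Ext.mk₀ h.r).comp x (zero_add n)) 0, Abelian.Ext.comp_zero]

end ExtComparison

section TorsionFreeInjective

variable {R : Type} [CommRing R]

/-- Zorn's lemma for submodules avoiding the nonzero elements of a set. -/
lemma Submodule.exists_maximal_avoiding {I : Type*} [AddCommGroup I] [Module R I] (T : Set I)
    (N : Submodule R I) (hN : ∀ x ∈ N, x ∈ T → x = 0) :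
    ∃ A : Submodule R I, N ≤ A ∧
      Maximal (fun A : Submodule R I => ∀ x ∈ A, x ∈ T → x = 0) A := by
  refine zorn_le_nonempty₀ {A : Submodule R I | ∀ x ∈ A, x ∈ T → x = 0} ?_ N hN
  intro c hc hchain y hy
  refine ⟨sSup c, fun x hx hxT => ?_, fun z hz => le_sSup hz⟩
  obtain ⟨A, hA, hxA⟩ := (Submodule.mem_sSup_of_directed ⟨y, hy⟩ hchain.directedOn).1 hx
  exact hc hA x hxA hxT

/-- In an injective module `I`, a submodule that is maximal among those meeting trivially a set
`T` closed under scalar multiplication is injective. -/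
lemma Submodule.injective_of_maximal_avoiding {I : Type} [AddCommGroup I] [Module R I]
    [Module.Injective R I] {T : Set I} (hT : ∀ (r : R), ∀ x ∈ T, r • x ∈ T) {A : Submodule R I}
    (hA : Maximal (fun A : Submodule R I => ∀ x ∈ A, x ∈ T → x = 0) A) :
    Module.Injective R A := by
  obtain ⟨B, -, hB⟩ := Submodule.exists_maximal_avoiding (A : Set I) (⊥ : Submodule R I)
    (fun x hx _ => by simpa using hx)
  have hj : Function.Injective (B.mkQ ∘ₗ A.subtype) := by
    rw [← LinearMap.ker_eq_bot, LinearMap.ker_eq_bot']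
    intro a ha
    exact Subtype.ext (hB.prop a ((Submodule.Quotient.mk_eq_zero B).1 ha) a.2)
  obtain ⟨h, hh⟩ := Module.Injective.out (B.mkQ ∘ₗ A.subtype) hj A.subtype
  have hrange : LinearMap.range h ≤ A := by
    refine hA.le_of_ge (y := LinearMap.range h) ?_ fun a ha => ⟨_, hh ⟨a, ha⟩⟩
    rintro _ ⟨q, rfl⟩ hq
    obtain ⟨x, rfl⟩ := B.mkQ_surjective q
    by_cases hx : x ∈ B
    · rw [Submodule.mkQ_apply, (Submodule.Quotient.mk_eq_zero B).2 hx, map_zero]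
    · exfalso
      apply hx
      refine hB.le_of_ge (y := B ⊔ Submodule.span R {x}) ?_ le_sup_left
        (Submodule.mem_sup_right (Submodule.mem_span_singleton_self x))
      intro a ha haA
      obtain ⟨b, hb, c, hc, rfl⟩ := Submodule.mem_sup.1 ha
      obtain ⟨r, rfl⟩ := Submodule.mem_span_singleton.1 hc
      refine hA.prop _ haA ?_
      have key : h (B.mkQ (b + r • x)) = b + r • x := hh ⟨_, haA⟩
      rw [map_add, Submodule.mkQ_apply, (Submodule.Quotient.mk_eq_zero B).2 hb, zero_add,
        map_smul, map_smul] at key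
      rw [← key]
      exact hT r _ hq
  refine ⟨fun X Y _ _ _ _ f hf g => ?_⟩
  obtain ⟨k, hk⟩ := Module.Injective.out f hf (A.subtype ∘ₗ g)
  refine ⟨(h.codRestrict A fun q => hrange ⟨q, rfl⟩) ∘ₗ B.mkQ ∘ₗ k, fun x => Subtype.ext ?_⟩
  simpa [hk] using hh (g x)

/-- A GV-torsion-free module embeds in a GV-torsion-free injective module. -/
lemma IsGVTorsionFree.exists_injective {N : Type} [AddCommGroup N] [Module R N]
    (hN : IsGVTorsionFree R N) :
    ∃ (E : ModuleCat.{0} R) (f : N →ₗ[R] E), Injective E ∧ IsGVTorsionFree R E ∧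
      Function.Injective f := by
  let I := Injective.under (ModuleCat.of R N)
  let ι : N →ₗ[R] I := (Injective.ι (ModuleCat.of R N)).hom
  have hι : Function.Injective ι := (ModuleCat.mono_iff_injective _).1 inferInstance
  have : Module.Injective R I :=
    (Module.injective_iff_injective_object R I).2 (inferInstanceAs (Injective I))
  let T : Set I := {x | ∃ J : Ideal R, IsGVIdeal R J ∧ ∀ j ∈ J, j • x = 0}
  obtain ⟨A, hNA, hA⟩ := Submodule.exists_maximal_avoiding T (LinearMap.range ι) (by
    rintro _ ⟨x, rfl⟩ ⟨J, hJ, hx⟩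
    rw [hN x ⟨J, hJ, fun j hj => hι (by rw [map_smul, hx j hj, map_zero])⟩, map_zero])
  refine ⟨ModuleCat.of R A, ι.codRestrict A fun x => hNA ⟨x, rfl⟩, ?_, ?_, ?_⟩
  · rw [← Module.injective_iff_injective_object]
    refine Submodule.injective_of_maximal_avoiding ?_ hA
    rintro r x ⟨J, hJ, hx⟩
    exact ⟨J, hJ, fun j hj => by rw [smul_comm, hx j hj, smul_zero]⟩
  · rintro x ⟨J, hJ, hx⟩
    exact Subtype.ext (hA.prop _ x.2 ⟨J, hJ, fun j hj => congrArg Subtype.val (hx j hj)⟩)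
  · intro x y hxy
    exact hι (congrArg Subtype.val hxy)

end TorsionFreeInjective

section WeakWProjective

variable {R : Type} [CommRing R]

lemma IsGVIdeal.isWProjective_quotient {J : Ideal R} (hJ : IsGVIdeal R J) :
    IsWProjective R (R ⧸ J) := by
  have htop : torGV R (R ⧸ J) = ⊤ := by
    refine eq_top_iff.2 fun x _ => Submodule.subset_span ⟨J, hJ, fun j hj => ?_⟩
    obtain ⟨r, rfl⟩ := Ideal.Quotient.mk_surjective x
    rw [← Ideal.Quotient.mk_eq_mk, ← Submodule.Quotient.mk_smul, Submodule.Quotient.mk_eq_zero]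
    exact J.mul_mem_right r hj
  have : Subsingleton ((R ⧸ J) ⧸ torGV R (R ⧸ J)) :=
    Submodule.Quotient.subsingleton_iff.2 htop
  intro N _ _ _ _ L _ _ ι hL
  have hL0 : ∀ x : L, x = 0 := by
    intro x
    obtain ⟨J', hJ', hx⟩ := hL.2.2 (Submodule.Quotient.mk x)
    refine hL.1.1 x ⟨J', hJ', fun j hj => ?_⟩
    have := hx j hj
    rw [← Submodule.Quotient.mk_smul, Submodule.Quotient.mk_eq_zero] at this
    obtain ⟨y, hy⟩ := this
    rw [← hy, Subsingleton.elim y 0, map_zero]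
  have : Subsingleton L := subsingleton_of_forall_eq 0 hL0
  have : Projective (ModuleCat.of R L) :=
    (ModuleCat.isZero_of_subsingleton (ModuleCat.of R L)).projective
  have : Subsingleton (extM R L N 1) :=
    (subsingleton_extM_succ_iff L N 0).2 (Abelian.Ext.subsingleton_of_projective _ _ 0)
  exact fun x => ⟨J, hJ, fun j _ => Subsingleton.elim _ _⟩

lemma MemPwDaggerInfty.ext_subsingleton {N M : Type} [AddCommGroup N] [Module R N]
    [AddCommGroup M] [Module R M] (hN : MemPwDaggerInfty R N) (hM : IsWProjective R M) (k : ℕ) :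
    Subsingleton (Abelian.Ext (ModuleCat.of R M) (ModuleCat.of R N) (k + 1)) :=
  (subsingleton_extM_succ_iff M N k).1 (hN.2 M hM (k + 1) (Nat.le_add_left 1 k))

/-- The class `P_w^{†∞}` is closed under some cosyzygy. -/
lemma MemPwDaggerInfty.exists_shortExact {N : Type} [AddCommGroup N] [Module R N]
    (hN : MemPwDaggerInfty R N) :
    ∃ (E C : ModuleCat.{0} R) (f : ModuleCat.of R N ⟶ E) (g : E ⟶ C) (w : f ≫ g = 0),
      (ShortComplex.mk f g w).ShortExact ∧ Injective E ∧ MemPwDaggerInfty R C := by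
  obtain ⟨E, f, hE, hEtf, hf⟩ := hN.1.exists_injective
  let C := ModuleCat.of R (E ⧸ LinearMap.range f)
  let g : E ⟶ C := ModuleCat.ofHom (LinearMap.range f).mkQ
  have w : ModuleCat.ofHom f ≫ g = 0 := by
    ext x
    exact (Submodule.Quotient.mk_eq_zero _).2 ⟨x, rfl⟩
  have hS : (ShortComplex.mk (ModuleCat.ofHom f) g w).ShortExact :=
    ModuleCat.shortComplex_shortExact _ (LinearMap.exact_map_mkQ_range f) hf
      (Submodule.mkQ_surjective _)
  refine ⟨E, C, ModuleCat.ofHom f, g, w, hS, hE, ?_, ?_⟩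
  · rintro x ⟨J, hJ, hx⟩
    have hext := hN.ext_subsingleton hJ.isWProjective_quotient 0
    let φ : ModuleCat.of R (R ⧸ J) ⟶ C :=
      ModuleCat.ofHom (J.liftQ (LinearMap.toSpanSingleton R C x) hx)
    obtain ⟨α, hα⟩ := Abelian.Ext.covariant_sequence_exact₃ (ModuleCat.of R (R ⧸ J)) hS
      (Abelian.Ext.mk₀ φ) (zero_add 1) (Subsingleton.elim _ _)
    obtain ⟨ψ, rfl⟩ := (Abelian.Ext.mk₀_bijective _ _).2 α
    rw [Abelian.Ext.mk₀_comp_mk₀] at hα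
    have hψ : ψ ≫ g = φ := (Abelian.Ext.mk₀_bijective _ _).1 hα
    have hy : ψ.hom (Submodule.Quotient.mk 1) = 0 := by
      refine hEtf _ ⟨J, hJ, fun j hj => ?_⟩
      rw [← map_smul, ← Submodule.Quotient.mk_smul, smul_eq_mul, mul_one,
        (Submodule.Quotient.mk_eq_zero J).2 hj, map_zero]
    have hφ : φ.hom (Submodule.Quotient.mk 1) = x := one_smul R x
    rw [← hφ, ← hψ, ModuleCat.hom_comp, LinearMap.comp_apply, hy, map_zero]
  · intro M _ _ hM k hk
    obtain ⟨k, rfl⟩ := Nat.exists_eq_add_of_le' hk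
    rw [subsingleton_extM_succ_iff]
    exact ext_subsingleton_X₃_of_covariant _ hS (Abelian.Ext.subsingleton_of_injective _ _ k)
      (hN.ext_subsingleton hM (k + 1))

lemma isWeakWProjective_iff (M : Type) [AddCommGroup M] [Module R M] :
    IsWeakWProjective R M ↔ ∀ (N : Type) [AddCommGroup N] [Module R N], MemPwDaggerInfty R N →
      Subsingleton (Abelian.Ext (ModuleCat.of R M) (ModuleCat.of R N) 1) :=
  forall_congr' fun N => forall_congr' fun _ => forall_congr' fun _ => forall_congr' fun _ =>
    subsingleton_extM_succ_iff M N 0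

lemma IsWeakWProjective.ext_subsingleton {M : Type} [AddCommGroup M] [Module R M]
    (hM : IsWeakWProjective R M) (k : ℕ) (N : Type) [AddCommGroup N] [Module R N]
    (hN : MemPwDaggerInfty R N) :
    Subsingleton (Abelian.Ext (ModuleCat.of R M) (ModuleCat.of R N) (k + 1)) := by
  induction k generalizing N with
  | zero => exact (isWeakWProjective_iff M).1 hM N hN
  | succ k ih =>
    obtain ⟨E, C, f, g, w, hS, hE, hC⟩ := hN.exists_shortExact
    exact ext_subsingleton_X₁_of_covariant _ hS (ih C hC)
      (Abelian.Ext.subsingleton_of_injective _ _ (k + 1))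

lemma isWeakWProjective_of_projective (M : Type) [AddCommGroup M] [Module R M]
    [Projective (ModuleCat.of R M)] : IsWeakWProjective R M :=
  (isWeakWProjective_iff M).2 fun _ _ _ _ => Abelian.Ext.subsingleton_of_projective _ _ 0

end WeakWProjective

section Dimension

variable {R : Type} [CommRing R]

lemma wwpdimLE_zero_of_isWeakWProjective {M : Type} [AddCommGroup M] [Module R M]
    (hM : IsWeakWProjective R M) : WWPdimLE R M 0 := by
  refine ⟨fun i => Nat.casesOn i (ModuleCat.of R M) fun _ => ModuleCat.of R PUnit, fun _ => 0,
    LinearMap.id, ?_, ?_, Function.surjective_id, ?_, ?_⟩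
  · rintro (_ | i)
    · exact hM
    · have : Projective (ModuleCat.of R PUnit) :=
        (ModuleCat.isZero_of_subsingleton (ModuleCat.of R PUnit)).projective
      exact isWeakWProjective_of_projective PUnit
  · rintro (_ | i) hi
    · exact absurd hi (lt_irrefl 0)
    · exact inferInstanceAs (Subsingleton PUnit)
  · intro x
    exact ⟨fun hx => ⟨PUnit.unit, hx.symm⟩, fun ⟨_, hx⟩ => hx.symm⟩
  · intro i x
    exact ⟨fun _ => ⟨PUnit.unit, rfl⟩, fun _ => rfl⟩

lemma wwpdimLE_succ_of_ker {P M : Type} [AddCommGroup P] [Module R P] [AddCommGroup M]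
    [Module R M] (hP : IsWeakWProjective R P) (p : P →ₗ[R] M) (hp : Function.Surjective p) {n : ℕ}
    (h : WWPdimLE R (LinearMap.ker p) n) : WWPdimLE R M (n + 1) := by
  obtain ⟨Q, d, e, hQ, hsub, he, hde, hdd⟩ := h
  refine ⟨fun i => Nat.casesOn i (ModuleCat.of R P) Q,
    fun i => Nat.casesOn i ((LinearMap.ker p).subtype ∘ₗ e) d, p, ?_, ?_, hp, ?_, ?_⟩
  · rintro (_ | i)
    · exact hP
    · exact hQ i
  · rintro (_ | i) hi
    · exact absurd hi (Nat.not_lt_zero _)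
    · exact hsub i (Nat.lt_of_succ_lt_succ hi)
  · intro x
    constructor
    · intro hx
      obtain ⟨q, hq⟩ := he ⟨x, hx⟩
      exact ⟨q, congrArg Subtype.val hq⟩
    · rintro ⟨q, rfl⟩
      exact (e q).2
  · rintro (_ | i)
    · intro x
      exact Subtype.ext_iff.symm.trans (hde x)
    · exact hdd i

lemma WWPdimLE.exists_ker {M : Type} [AddCommGroup M] [Module R M] {n : ℕ}
    (h : WWPdimLE R M (n + 1)) :
    ∃ (P : ModuleCat.{0} R) (p : P →ₗ[R] M), IsWeakWProjective R P ∧ Function.Surjective p ∧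
      WWPdimLE R (LinearMap.ker p) n := by
  obtain ⟨P, d, e, hP, hsub, he, hde, hdd⟩ := h
  refine ⟨P 0, e, hP 0, he, fun i => P (i + 1), fun i => d (i + 1),
    (d 0).codRestrict (LinearMap.ker e) fun x => (hde _).2 ⟨x, rfl⟩, fun i => hP (i + 1),
    fun i hi => hsub (i + 1) (Nat.succ_lt_succ hi), ?_, ?_, fun i => hdd (i + 1)⟩
  · rintro ⟨x, hx⟩
    obtain ⟨y, hy⟩ := (hde x).1 hx
    exact ⟨y, Subtype.ext hy⟩
  · intro x
    exact Subtype.ext_iff.trans (hdd 0 x)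

lemma WWPdimLE.isWeakWProjective {M : Type} [AddCommGroup M] [Module R M]
    (h : WWPdimLE R M 0) : IsWeakWProjective R M := by
  obtain ⟨P, d, e, hP, hsub, he, hde, -⟩ := h
  have := hsub 1 zero_lt_one
  have hinj : Function.Injective e := by
    rw [← LinearMap.ker_eq_bot, LinearMap.ker_eq_bot']
    intro x hx
    obtain ⟨y, rfl⟩ := (hde x).1 hx
    rw [Subsingleton.elim y 0, map_zero]
  let eqv : ModuleCat.of R (P 0) ≅ ModuleCat.of R M :=
    (LinearEquiv.ofBijective e ⟨hinj, he⟩).toModuleIso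
  rw [isWeakWProjective_iff]
  intro N _ _ hN
  exact ext_subsingleton_of_retract _ eqv.symm.retract ((hP 0).ext_subsingleton 0 N hN)

lemma wwpdimLE_iff (M : Type) [AddCommGroup M] [Module R M] (n : ℕ) :
    WWPdimLE R M n ↔ ∀ (N : Type) [AddCommGroup N] [Module R N], MemPwDaggerInfty R N →
      Subsingleton (Abelian.Ext (ModuleCat.of R M) (ModuleCat.of R N) (n + 1)) := by
  induction n generalizing M with
  | zero =>
    exact ⟨fun h => (isWeakWProjective_iff M).1 h.isWeakWProjective,
      fun h => wwpdimLE_zero_of_isWeakWProjective ((isWeakWProjective_iff M).2 h)⟩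
  | succ n ih =>
    constructor
    · intro h N _ _ hN
      obtain ⟨P, p, hP, hp, hK⟩ := h.exists_ker
      exact ext_subsingleton_X₃_of_contravariant _ (LinearMap.shortExact_shortComplexKer hp)
        ((ih _).1 hK N hN) (hP.ext_subsingleton (n + 1) N hN)
    · intro h
      have hS := (ModuleCat.of R M).shortExact_projectiveShortComplex
      have hproj : Projective (ModuleCat.of R (M →₀ Shrink.{0} R)) :=
        ModuleCat.projective_of_free (Module.Free.chooseBasis R (M →₀ Shrink.{0} R))
      refine wwpdimLE_succ_of_ker (P := M →₀ Shrink.{0} R)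
        (isWeakWProjective_of_projective _) _ ((ModuleCat.epi_iff_surjective _).1 hS.epi_g) ?_
      refine (ih _).2 fun N _ _ hN => ?_
      exact ext_subsingleton_X₁_of_contravariant _ hS
        (Abelian.Ext.subsingleton_of_projective (ModuleCat.of R (M →₀ Shrink.{0} R)) _ n) (h N hN)

lemma wwpdimLE_prod_iff (M N : Type) [AddCommGroup M] [Module R M] [AddCommGroup N] [Module R N]
    (n : ℕ) : WWPdimLE R (M × N) n ↔ WWPdimLE R M n ∧ WWPdimLE R N n := by
  simp only [wwpdimLE_iff]
  constructor
  · refine fun h => ⟨fun X _ _ hX => ext_subsingleton_of_retract _ ⟨ModuleCat.ofHom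
      (LinearMap.inl R M N), ModuleCat.ofHom (LinearMap.fst R M N), rfl⟩ (h X hX),
      fun X _ _ hX => ext_subsingleton_of_retract _ ⟨ModuleCat.ofHom
      (LinearMap.inr R M N), ModuleCat.ofHom (LinearMap.snd R M N), rfl⟩ (h X hX)⟩
  · rintro ⟨hM, hN⟩ X _ _ hX
    have hS : (ShortComplex.mk (ModuleCat.ofHom (LinearMap.inl R M N))
        (ModuleCat.ofHom (LinearMap.snd R M N)) rfl).ShortExact :=
      ModuleCat.shortComplex_shortExact _ Function.Exact.inl_snd LinearMap.inl_injective
        LinearMap.snd_surjective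
    have := hM X hX
    have := hN X hX
    refine subsingleton_of_forall_eq 0 fun x => ?_
    obtain ⟨y, rfl⟩ := Abelian.Ext.contravariant_sequence_exact₂ hS _ x (Subsingleton.elim _ _)
    rw [Subsingleton.elim y 0, Abelian.Ext.comp_zero]

lemma wwpd_le_natCast_iff (M : Type) [AddCommGroup M] [Module R M] (n : ℕ) :
    wwpd R M ≤ n ↔ WWPdimLE R M n := by
  constructor
  · intro h
    have hne : {c : ℕ∞ | ∃ n : ℕ, c = n ∧ WWPdimLE R M n}.Nonempty := by
      by_contra hempty
      rw [Set.not_nonempty_iff_eq_empty] at hempty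
      rw [wwpd, hempty, sInf_empty, top_le_iff] at h
      exact ENat.natCast_ne_top n h
    obtain ⟨m, hm, P, d, e, hP, hsub, hex⟩ := csInf_mem hne
    have hmn : m ≤ n := by
      rw [wwpd, hm] at h
      exact_mod_cast h
    exact ⟨P, d, e, hP, fun i hi => hsub i (hmn.trans_lt hi), hex⟩
  · exact fun h => sInf_le ⟨n, rfl, h⟩

end Dimension

/-- the weak `w`-projective dimension of `M ⊕ N` is the supremum of the
weak `w`-projective dimensions of `M` and `N`. -/
theorem wwpd_prod (R : Type) [CommRing R]
    (M N : Type) [AddCommGroup M] [Module R M] [AddCommGroup N] [Module R N] :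
    wwpd R (M × N) = max (wwpd R M) (wwpd R N) := by
  refine eq_of_forall_ge_iff fun c => ?_
  induction c using ENat.recTopCoe with
  | top => simp only [le_top]
  | coe n => rw [max_le_iff, wwpd_le_natCast_iff, wwpd_le_natCast_iff, wwpd_le_natCast_iff,
      wwpdimLE_prod_iff]
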